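/- Suppose the collection 𝒫_A^⊆ of potential-outcome distributions obeys distributional consistency. Let B and C be disjoint subsets of A (C possibly empty) and let Y, W be disjoint subsets of V∖B. Then for all y ∈ 𝔛_Y, b ∈ 𝔛_B, c ∈ 𝔛_C, w ∈ 𝔛_W with p(X_B(c) = b, X_W(c) = w) > 0: p(X_Y(b,c) = y | X_B(b,c) = b, X_W(b,c) = w) = p(X_Y(c) = y | X_B(c) = b, X_W(c) = w); in particular the conditioning event on the left also has positive probability. -/

import Mathlib

open Finset

namespace CausalPaper

variable {V : Type*} [Fintype V] [DecidableEq V]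
variable {𝔛 : V → Type*} [∀ i, Fintype (𝔛 i)]

/-- Probability of the event `E` under the distribution `q` on joint assignments. -/
noncomputable def pr (q : (∀ i, 𝔛 i) → ℝ) (E : (∀ i, 𝔛 i) → Prop) : ℝ :=
  ∑ v : (∀ i, 𝔛 i), Set.indicator (setOf E) q v

/-- Conditional probability of `E` given `F` under `q`. -/
noncomputable def cpr (q : (∀ i, 𝔛 i) → ℝ) (E F : (∀ i, 𝔛 i) → Prop) : ℝ :=
  pr q (fun v => E v ∧ F v) / pr q F

/-- `q` is a probability distribution on joint assignments. -/
def IsProb (q : (∀ i, 𝔛 i) → ℝ) : Prop :=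
  (∀ v, 0 ≤ q v) ∧ (∑ v : (∀ i, 𝔛 i), q v) = 1

/-- `v` agrees with `s` on the coordinates in `S`. -/
def agree (S : Finset V) (s v : ∀ i, 𝔛 i) : Prop :=
  ∀ i ∈ S, v i = s i

/-- The intervention/regime that sets the variables in `B` according to `b`
(and is idle elsewhere). -/
def setOn (B : Finset V) (b : ∀ i, 𝔛 i) : ∀ i, Option (𝔛 i) :=
  fun i => if i ∈ B then some (b i) else none

/-- The intervention/regime that sets `B` according to `b` and `C` according to `c`. -/
def setOn₂ (B : Finset V) (b : ∀ i, 𝔛 i) (C : Finset V) (c : ∀ i, 𝔛 i) :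
    ∀ i, Option (𝔛 i) :=
  fun i => if i ∈ B then some (b i) else if i ∈ C then some (c i) else none

/-- The support of the partial intervention/regime `f` is contained in `A`. -/
def suppIn (f : ∀ i, Option (𝔛 i)) (A : Finset V) : Prop :=
  ∀ i, f i ≠ none → i ∈ A

/-- Distributional consistency: for `i ∈ A`, `C ⊆ A \ {i}`, the probability of the
event `{X_{V∖{i}} = y, X_i = b}` is the same whether or not `i` is additionally
intervened on and set to `b`. -/
def DistConsistent (A : Finset V) (P : (∀ i, Option (𝔛 i)) → (∀ i, 𝔛 i) → ℝ) : Prop :=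
  ∀ i ∈ A, ∀ C : Finset V, C ⊆ A \ {i} →
    ∀ (y : ∀ j, 𝔛 j) (b : 𝔛 i) (c : ∀ j, 𝔛 j),
      pr (P (Function.update (setOn C c) i (some b)))
          (fun v => agree (univ \ {i}) y v ∧ v i = b)
        = pr (P (setOn C c)) (fun v => agree (univ \ {i}) y v ∧ v i = b)

theorem pr_eq_of_forall_eq (q : (∀ i, 𝔛 i) → ℝ) (E : (∀ i, 𝔛 i) → Prop) (v : ∀ i, 𝔛 i)
    (hE : ∀ u, E u ↔ u = v) : pr q E = q v := by
  unfold pr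
  rw [Finset.sum_eq_single v]
  · exact Set.indicator_of_mem ((hE v).2 rfl) q
  · exact fun u _ hu => Set.indicator_of_notMem (fun h => hu ((hE u).1 h)) q
  · exact fun h => absurd (Finset.mem_univ v) h

theorem pr_congr {q r : (∀ i, 𝔛 i) → ℝ} {E : (∀ i, 𝔛 i) → Prop}
    (h : ∀ v, E v → q v = r v) : pr q E = pr r E :=
  Finset.sum_congr rfl fun v _ => by
    by_cases hv : E v
    · exact (Set.indicator_of_mem hv q).trans ((h v hv).trans (Set.indicator_of_mem hv r).symm)
    · exact (Set.indicator_of_notMem hv q).trans (Set.indicator_of_notMem hv r).symm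

theorem setOn_union_piecewise {ι : Type*} [DecidableEq ι] {α : ι → Type*} (B C : Finset ι)
    (b c : ∀ i, α i) :
    setOn (B ∪ C) (B.piecewise b c) = setOn₂ B b C c := by
  funext i
  by_cases hB : i ∈ B <;> by_cases hC : i ∈ C <;> simp [setOn, setOn₂, hB, hC]

theorem setOn₂_insert {ι : Type*} [DecidableEq ι] {α : ι → Type*} (B C : Finset ι)
    (b c : ∀ i, α i) (i : ι) :
    setOn₂ (insert i B) b C c = Function.update (setOn₂ B b C c) i (some (b i)) := by
  funext j
  by_cases hj : j = i
  · subst hj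
    simp [setOn₂]
  · simp [setOn₂, hj]

/-- Distributional consistency, stated for the probability of a single joint assignment. -/
theorem DistConsistent.apply_update {A : Finset V}
    {P : (∀ i, Option (𝔛 i)) → (∀ i, 𝔛 i) → ℝ} (hDC : DistConsistent A P) {i : V} (hi : i ∈ A)
    {C : Finset V} (hC : C ⊆ A \ {i}) (c v : ∀ j, 𝔛 j) :
    P (Function.update (setOn C c) i (some (v i))) v = P (setOn C c) v := by
  have hE : ∀ u : ∀ j, 𝔛 j, (agree (univ \ {i}) v u ∧ u i = v i) ↔ u = v := by
    refine fun u => ⟨fun h => funext fun j => ?_, ?_⟩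
    · by_cases hj : j = i
      · exact hj ▸ h.2
      · exact h.1 j (by simp [hj])
    · rintro rfl
      exact ⟨fun _ _ => rfl, rfl⟩
  simpa only [pr_eq_of_forall_eq _ _ v hE] using hDC i hi C hC v (v i) c

/-- Intervening on `B` does not change the probability of a joint assignment which already
takes the intervened values on `B`. -/
theorem DistConsistent.apply_setOn₂ {A : Finset V}
    {P : (∀ i, Option (𝔛 i)) → (∀ i, 𝔛 i) → ℝ} (hDC : DistConsistent A P)
    {B C : Finset V} (hBA : B ⊆ A) (hCA : C ⊆ A) (hBC : Disjoint B C) {b v : ∀ j, 𝔛 j}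
    (c : ∀ j, 𝔛 j) (hv : agree B b v) :
    P (setOn₂ B b C c) v = P (setOn C c) v := by
  induction B using Finset.induction_on with
  | empty =>
    have h : setOn₂ ∅ b C c = setOn C c := by
      funext i
      simp [setOn₂, setOn]
    rw [h]
  | insert i B hiB ih =>
    obtain ⟨hiA, hBA'⟩ := Finset.insert_subset_iff.1 hBA
    obtain ⟨hiC, hBC'⟩ := Finset.disjoint_insert_left.1 hBC
    have hsub : B ∪ C ⊆ A \ {i} := by
      rw [Finset.sdiff_singleton_eq_erase, Finset.subset_erase]
      exact ⟨Finset.union_subset hBA' hCA, by simp [hiB, hiC]⟩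
    rw [setOn₂_insert, ← setOn_union_piecewise, ← hv i (Finset.mem_insert_self i B),
      hDC.apply_update hiA hsub, setOn_union_piecewise]
    exact ih hBA' hBC' fun j hj => hv j (Finset.mem_insert_of_mem hj)

/-- Lemma 2: equality of conditional distributions given `X_B = b, X_W = w`,
with and without the intervention setting `B` to `b`. -/
theorem stmt1_cond_consistency
    (A B C : Finset V) (hBA : B ⊆ A) (hCA : C ⊆ A) (hBC : Disjoint B C)
    (Y W : Finset V) (hYW : Disjoint Y W)
    (hY : Y ⊆ univ \ B) (hW : W ⊆ univ \ B)
    (P : (∀ i, Option (𝔛 i)) → (∀ i, 𝔛 i) → ℝ)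
    (hP : ∀ f, suppIn f A → IsProb (P f))
    (hDC : DistConsistent A P)
    (y b c w : ∀ j, 𝔛 j)
    (hpos : 0 < pr (P (setOn C c)) (fun v => agree B b v ∧ agree W w v)) :
    0 < pr (P (setOn₂ B b C c)) (fun v => agree B b v ∧ agree W w v) ∧
    cpr (P (setOn₂ B b C c)) (agree Y y) (fun v => agree B b v ∧ agree W w v)
      = cpr (P (setOn C c)) (agree Y y) (fun v => agree B b v ∧ agree W w v) := by
  have h : ∀ v, agree B b v → P (setOn₂ B b C c) v = P (setOn C c) v :=
    fun v hv => hDC.apply_setOn₂ hBA hCA hBC c hv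
  have hF := pr_congr (E := fun v => agree B b v ∧ agree W w v) fun v hv => h v hv.1
  refine ⟨hF ▸ hpos, ?_⟩
  unfold cpr
  rw [hF, pr_congr fun v hv => h v hv.2.1]

end CausalPaper
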